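/- Let s and t be coprime positive integers and n, m integers with 0 < n < s and 0 < m < t. For every τ ∈ ℂ with Im τ > 0, the theta series Φ_{s,t}^{(n,m)}(τ) := (1/2) Σ_{k∈ℤ} χ_{n,m}(k)·exp( 2πiτ·k²/(4st) ) satisfies Φ_{s,t}^{(n,m)}(τ) = (i/τ)^{1/2} · Σ_{(n′,m′)} S_{n,m}^{n′,m′} · Φ_{s,t}^{(n′,m′)}(−1/τ), where the sum runs over all pairs of integers (n′, m′) with 1 ≤ n′ ≤ s−1, 1 ≤ m′ ≤ t−1 and n′t − m′s > 0, and S_{n,m}^{n′,m′} = √(8/(st)) · (−1)^{nm′ + n′m + 1} · sin( nn′tπ/s ) · sin( mm′sπ/t ); the square root (i/τ)^{1/2} is the principal branch. -/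

import Mathlib

open Complex Finset

/-- The 2st-periodic function `χ_{a,b} = χ_{2st}^{(a,b)}`. -/
def chi (s t a b k : ℤ) : ℤ :=
  if k ≡ a * t - b * s [ZMOD 2 * s * t] ∨ k ≡ -(a * t - b * s) [ZMOD 2 * s * t] then 1
  else if k ≡ a * t + b * s [ZMOD 2 * s * t] ∨ k ≡ -(a * t + b * s) [ZMOD 2 * s * t] then -1
  else 0

/-- The theta series `Φ_{s,t}^{(a,b)}(τ)`. -/
noncomputable def Phi (s t a b : ℤ) (τ : ℂ) : ℂ :=
  (1 / 2) * ∑' k : ℤ, (chi s t a b k : ℂ) *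
    Complex.exp (2 * Real.pi * Complex.I * τ * (k : ℂ) ^ 2 / (4 * s * t))

/-- The `S`-matrix coefficient `S(s,t)_{n,m}^{n',m'}`. -/
noncomputable def Scoef (s t n m n' m' : ℤ) : ℝ :=
  Real.sqrt (8 / ((s : ℝ) * t)) * (-1 : ℝ) ^ (n * m' + n' * m + 1) *
    Real.sin ((n : ℝ) * n' * t * Real.pi / s) * Real.sin ((m : ℝ) * m' * s * Real.pi / t)


lemma chi_eq (s t a b : ℤ) (hs : 0 < s) (ht : 0 < t) (hst : IsCoprime s t)
    (ha : 0 < a) (has : a < s) (hb : 0 < b) (hbt : b < t) (k : ℤ) :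
    chi s t a b k = (if k ≡ a * t - b * s [ZMOD 2 * s * t] then 1 else 0)
      + (if k ≡ -(a * t - b * s) [ZMOD 2 * s * t] then 1 else 0)
      - (if k ≡ a * t + b * s [ZMOD 2 * s * t] then 1 else 0)
      - (if k ≡ -(a * t + b * s) [ZMOD 2 * s * t] then 1 else 0) := by
  have nos : ∀ x : ℤ, x = a ∨ x = -a → ∀ j, x ≠ s * j := by
    intro x hx j h
    have h1 : s ∣ a := by
      rcases hx with rfl | rfl
      · exact ⟨j, h⟩
      · exact (dvd_neg.mp ⟨j, h⟩)
    have := Int.le_of_dvd ha h1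
    omega
  have nob : ∀ x : ℤ, x = b ∨ x = -b → ∀ j, x ≠ t * j := by
    intro x hx j h
    have h1 : t ∣ b := by
      rcases hx with rfl | rfl
      · exact ⟨j, h⟩
      · exact (dvd_neg.mp ⟨j, h⟩)
    have := Int.le_of_dvd hb h1
    omega
  have nost : ∀ (x y : ℤ), x = a ∨ x = -a → ∀ j, x * t + y * s ≠ s * t * j := by
    intro x y hx j h
    have h1 : s ∣ x * t := ⟨t * j - y, by linarith⟩
    have h2 : s ∣ x := hst.dvd_of_dvd_mul_right h1
    obtain ⟨j, hj⟩ := h2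
    exact nos x hx j hj
  have d : ∀ u v : ℤ, k ≡ u [ZMOD 2 * s * t] → k ≡ v [ZMOD 2 * s * t] →
      ∃ j, u - v = 2 * (s * t * j) := by
    intro u v h1 h2
    obtain ⟨j, hj⟩ := (h2.symm.trans h1).dvd
    exact ⟨j, by linarith⟩
  have h12 : k ≡ a * t - b * s [ZMOD 2 * s * t] → ¬ k ≡ -(a * t - b * s) [ZMOD 2 * s * t] := by
    intro h1 h2
    obtain ⟨j, hj⟩ := d _ _ h1 h2
    exact nost a (-b) (Or.inl rfl) j (by linarith)
  have h34 : k ≡ a * t + b * s [ZMOD 2 * s * t] → ¬ k ≡ -(a * t + b * s) [ZMOD 2 * s * t] := by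
    intro h1 h2
    obtain ⟨j, hj⟩ := d _ _ h1 h2
    exact nost a b (Or.inl rfl) j (by linarith)
  have h13 : k ≡ a * t - b * s [ZMOD 2 * s * t] → ¬ k ≡ (a * t + b * s) [ZMOD 2 * s * t] := by
    intro h1 h2
    obtain ⟨j, hj⟩ := d _ _ h1 h2
    exact nob (-b) (Or.inr rfl) j (mul_left_cancel₀ hs.ne' (by linarith))
  have h14 : k ≡ a * t - b * s [ZMOD 2 * s * t] → ¬ k ≡ -(a * t + b * s) [ZMOD 2 * s * t] := by
    intro h1 h2
    obtain ⟨j, hj⟩ := d _ _ h1 h2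
    exact nos a (Or.inl rfl) j (mul_left_cancel₀ ht.ne' (by linarith))
  have h23 : k ≡ -(a * t - b * s) [ZMOD 2 * s * t] → ¬ k ≡ (a * t + b * s) [ZMOD 2 * s * t] := by
    intro h1 h2
    obtain ⟨j, hj⟩ := d _ _ h1 h2
    exact nos (-a) (Or.inr rfl) j (mul_left_cancel₀ ht.ne' (by linarith))
  have h24 : k ≡ -(a * t - b * s) [ZMOD 2 * s * t] → ¬ k ≡ -(a * t + b * s) [ZMOD 2 * s * t] := by
    intro h1 h2
    obtain ⟨j, hj⟩ := d _ _ h1 h2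
    exact nob b (Or.inl rfl) j (mul_left_cancel₀ hs.ne' (by linarith))
  unfold chi
  by_cases c1 : k ≡ a * t - b * s [ZMOD 2 * s * t]
  · simp only [c1, h12 c1, h13 c1, h14 c1, if_true, if_false, true_or]; norm_num
  by_cases c2 : k ≡ -(a * t - b * s) [ZMOD 2 * s * t]
  · simp only [c1, c2, h23 c2, h24 c2, if_true, if_false, or_true]; norm_num
  by_cases c3 : k ≡ (a * t + b * s) [ZMOD 2 * s * t]
  · simp only [c1, c2, c3, h34 c3, if_true, if_false, true_or, or_false]; norm_num
  by_cases c4 : k ≡ -(a * t + b * s) [ZMOD 2 * s * t]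
  · simp only [c1, c2, c3, c4, if_true, if_false, or_true, or_false]; norm_num
  simp only [c1, c2, c3, c4, if_false, or_false]; norm_num

/-- Signed form of nonvanishing of `chi`. -/
lemma chi_ne_zero (s t a b k : ℤ) (h : chi s t a b k ≠ 0) :
    ∃ e d j : ℤ, (e = 1 ∨ e = -1) ∧ (d = 1 ∨ d = -1) ∧
      k = e * a * t + d * b * s + 2 * s * t * j ∧ chi s t a b k = -(e * d) := by
  unfold chi at h ⊢
  split_ifs at h ⊢ with h1 h2
  · rcases h1 with h1 | h1
    · obtain ⟨j, hj⟩ := h1.symm.dvd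
      exact ⟨1, -1, j, by simp, by simp, by linarith, by simp⟩
    · obtain ⟨j, hj⟩ := h1.symm.dvd
      exact ⟨-1, 1, j, by simp, by simp, by linarith, by simp⟩
  · rcases h2 with h1 | h1
    · obtain ⟨j, hj⟩ := h1.symm.dvd
      exact ⟨1, 1, j, by simp, by simp, by linarith, by simp⟩
    · obtain ⟨j, hj⟩ := h1.symm.dvd
      exact ⟨-1, -1, j, by simp, by simp, by linarith, by simp⟩
  · exact absurd rfl h

lemma chi_ne_zero_of (s t a b k : ℤ) (e d j : ℤ) (he : e = 1 ∨ e = -1) (hd : d = 1 ∨ d = -1)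
    (hk : k = e * a * t + d * b * s + 2 * s * t * j) : chi s t a b k ≠ 0 := by
  have H : ∀ u : ℤ, k = u + 2 * s * t * j → k ≡ u [ZMOD 2 * s * t] := by
    intro u hu
    exact (Int.modEq_iff_dvd.mpr ⟨j, by linarith⟩ : u ≡ k [ZMOD _]).symm
  unfold chi
  split_ifs with h1 h2
  · simp
  · simp
  · exfalso
    rcases he with rfl | rfl <;> rcases hd with rfl | rfl
    · exact h2 (Or.inl (H _ (by linarith)))
    · exact h1 (Or.inl (H _ (by linarith)))
    · exact h1 (Or.inr (H _ (by linarith)))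
    · exact h2 (Or.inr (H _ (by linarith)))

lemma chi_unique (s t a b a' b' k : ℤ) (hs : 0 < s) (ht : 0 < t) (hst : IsCoprime s t)
    (ha : 0 < a) (has : a < s) (hb : 0 < b) (hbt : b < t)
    (ha' : 0 < a') (has' : a' < s) (hb' : 0 < b') (hbt' : b' < t)
    (hp : 0 < a * t - b * s) (hp' : 0 < a' * t - b' * s)
    (h : chi s t a b k ≠ 0) (h' : chi s t a' b' k ≠ 0) : a = a' ∧ b = b' := by
  obtain ⟨e, d, j, he, hd, hk, -⟩ := chi_ne_zero _ _ _ _ _ h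
  obtain ⟨e', d', j', he', hd', hk', -⟩ := chi_ne_zero _ _ _ _ _ h'
  have h1 : s ∣ (e * a - e' * a') * t := ⟨d' * b' - d * b + 2 * t * (j' - j), by linarith⟩
  obtain ⟨u, hu⟩ := hst.dvd_of_dvd_mul_right h1
  have hv : d' * b' - d * b = t * (u - 2 * (j' - j)) := by
    apply mul_left_cancel₀ hs.ne'
    have : s * u * t = (e * a - e' * a') * t := by rw [hu]
    linarith
  obtain ⟨v, hv'⟩ : ∃ v, v = u - 2 * (j' - j) := ⟨_, rfl⟩
  rw [← hv'] at hv
  have hu1 : u < 2 := by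
    by_contra hc
    have : s * 2 ≤ s * u := by gcongr; omega
    rcases he with rfl | rfl <;> rcases he' with rfl | rfl <;> linarith
  have hu2 : -2 < u := by
    by_contra hc
    have : s * u ≤ s * (-2) := by gcongr; omega
    rcases he with rfl | rfl <;> rcases he' with rfl | rfl <;> linarith
  have hv1 : v < 2 := by
    by_contra hc
    have : t * 2 ≤ t * v := by gcongr; omega
    rcases hd with rfl | rfl <;> rcases hd' with rfl | rfl <;> linarith
  have hv2 : -2 < v := by
    by_contra hc
    have : t * v ≤ t * (-2) := by gcongr; omega
    rcases hd with rfl | rfl <;> rcases hd' with rfl | rfl <;> linarith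
  have huv : (a = a' ∧ b = b') ∨ (a' = s - a ∧ b' = t - b) := by
    clear h1 hk hk' h h' hp hp' hst
    have hu3 : u = -1 ∨ u = 0 ∨ u = 1 := by omega
    have hv3 : v = -1 ∨ v = 0 ∨ v = 1 := by omega
    rcases hu3 with rfl | rfl | rfl <;> rcases hv3 with rfl | rfl | rfl <;>
    rcases he with rfl | rfl <;> rcases he' with rfl | rfl <;>
    rcases hd with rfl | rfl <;> rcases hd' with rfl | rfl <;> omega
  rcases huv with h | ⟨rfl, rfl⟩
  · exact h
  · exfalso; linarith

lemma chi_exists (s t k : ℤ) (hs : 0 < s) (ht : 0 < t) (hst : IsCoprime s t)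
    (hks : ¬ s ∣ k) (hkt : ¬ t ∣ k) :
    ∃ a b : ℤ, 0 < a ∧ a < s ∧ 0 < b ∧ b < t ∧ 0 < a * t - b * s ∧ chi s t a b k ≠ 0 := by
  obtain ⟨x, y, hxy⟩ := id hst
  -- x * s + y * t = 1
  obtain ⟨a, qa, ha0, has, hqa⟩ : ∃ a q, 0 ≤ a ∧ a < s ∧ k * y = a + s * q :=
    ⟨k * y % s, k * y / s, Int.emod_nonneg _ hs.ne', Int.emod_lt_of_pos _ hs,
      (Int.emod_add_mul_ediv _ _).symm⟩
  obtain ⟨b, qb, hb0, hbt, hqb⟩ : ∃ b q, 0 ≤ b ∧ b < t ∧ k * x = b + t * q :=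
    ⟨k * x % t, k * x / t, Int.emod_nonneg _ ht.ne', Int.emod_lt_of_pos _ ht,
      (Int.emod_add_mul_ediv _ _).symm⟩
  have hk : k = a * t + b * s + s * t * (qa + qb) := by
    have : k = k * x * s + k * y * t := by linear_combination -k * hxy
    rw [hqa, hqb] at this
    linarith
  have ha : 0 < a := by
    rcases ha0.eq_or_lt with h | h
    · exact absurd ⟨b + t * (qa + qb), by rw [hk, ← h]; ring⟩ hks
    · exact h
  have hb : 0 < b := by
    rcases hb0.eq_or_lt with h | h
    · exact absurd ⟨a + s * (qa + qb), by rw [hk, ← h]; ring⟩ hkt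
    · exact h
  have nz : ∀ a' b' : ℤ, 0 < a' → a' < s → a' * t - b' * s ≠ 0 := by
    intro a' b' h1 h2 h3
    have : s ∣ a' := hst.dvd_of_dvd_mul_right ⟨b', by linarith⟩
    have := Int.le_of_dvd h1 this
    omega
  rcases Int.even_or_odd' (qa + qb) with ⟨c, hc | hc⟩
  · rw [hc] at hk
    rcases lt_or_gt_of_ne (nz a b ha has) with h | h
    · refine ⟨s - a, t - b, by omega, by omega, by omega, by omega, by linarith,
        chi_ne_zero_of _ _ _ _ _ (-1) (-1) (c + 1) (by simp) (by simp) (by linarith)⟩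
    · exact ⟨a, b, ha, has, hb, hbt, h,
        chi_ne_zero_of _ _ _ _ _ 1 1 c (by simp) (by simp) (by linarith)⟩
  · rw [hc] at hk
    rcases lt_or_gt_of_ne (nz a (t - b) ha has) with h | h
    · refine ⟨s - a, b, by omega, by omega, by omega, by omega, by linarith,
        chi_ne_zero_of _ _ _ _ _ (-1) (1) (c + 1) (by simp) (by simp) (by linarith)⟩
    · exact ⟨a, t - b, ha, has, by omega, by omega, h,
        chi_ne_zero_of _ _ _ _ _ 1 (-1) (c + 1) (by simp) (by simp) (by linarith)⟩

/-- The Gaussian term. -/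
noncomputable def gterm (s t : ℤ) (τ : ℂ) (k : ℤ) : ℂ :=
  Complex.exp (2 * Real.pi * Complex.I * τ * (k : ℂ) ^ 2 / (4 * s * t))

lemma summable_gterm_mul (s t : ℤ) (hs : 0 < s) (ht : 0 < t) (τ : ℂ) (hτ : 0 < τ.im)
    (f : ℤ → ℂ) (C : ℝ) (hf : ∀ k, ‖f k‖ ≤ C) : Summable fun k => f k * gterm s t τ k := by
  have hs' : (s : ℂ) ≠ 0 := by exact_mod_cast hs.ne'
  have ht' : (t : ℂ) ≠ 0 := by exact_mod_cast ht.ne'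
  have hN : (0 : ℝ) < (2 * s * t : ℝ)⁻¹ := by
    have : (0 : ℝ) < s := by exact_mod_cast hs
    have : (0 : ℝ) < t := by exact_mod_cast ht
    positivity
  have him : 0 < (((2 * s * t : ℝ)⁻¹ : ℝ) * τ).im := by
    rw [Complex.im_ofReal_mul]; positivity
  have h := (summable_jacobiTheta₂_term_iff 0 (((2 * s * t : ℝ)⁻¹ : ℝ) * τ)).mpr him
  have h2 : Summable (gterm s t τ) := by
    refine h.congr ?_
    intro k
    unfold gterm jacobiTheta₂_term
    congr 1
    push_cast
    field_simp
    ring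
  refine Summable.of_norm_bounded (h2.norm.mul_left C) ?_
  intro k
  rw [norm_mul]
  gcongr
  exact hf k

lemma neg_inv_im (τ : ℂ) (hτ : 0 < τ.im) : 0 < (-1 / τ).im := by
  have h0 : τ ≠ 0 := by rintro rfl; simp at hτ
  have : 0 < Complex.normSq τ := Complex.normSq_pos.mpr h0
  rw [neg_div, one_div, Complex.neg_im, Complex.inv_im]
  rw [neg_div, neg_neg]
  positivity

lemma cpow_half_scale (r : ℝ) (hr : 0 < r) (z : ℂ) (hz : z ≠ 0) :
    ((r : ℂ) * z) ^ ((1 : ℂ) / 2) = (Real.sqrt r : ℂ) * z ^ ((1 : ℂ) / 2) := by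
  have hr' : (r : ℂ) ≠ 0 := by exact_mod_cast hr.ne'
  rw [Complex.cpow_def_of_ne_zero (mul_ne_zero hr' hz), Complex.log_ofReal_mul hr hz, add_mul,
    Complex.exp_add, ← Complex.cpow_def_of_ne_zero hz, Real.sqrt_eq_rpow,
    Complex.ofReal_cpow hr.le, Complex.cpow_def_of_ne_zero hr', Complex.ofReal_log hr.le]
  norm_num

lemma tsum_class (s t c : ℤ) (hs : 0 < s) (ht : 0 < t) (τ : ℂ) (hτ : 0 < τ.im) :
    ∑' k : ℤ, (if k ≡ c [ZMOD 2 * s * t] then (1 : ℂ) else 0) * gterm s t τ k =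
      (Complex.I / τ) ^ ((1 : ℂ) / 2) * (Real.sqrt (2 * s * t)⁻¹ : ℂ) *
        ∑' k : ℤ, Complex.exp (-(Real.pi * c * k / (s * t) : ℝ) * Complex.I)
          * gterm s t (-1 / τ) k := by
  have h0 : τ ≠ 0 := by rintro rfl; simp at hτ
  have hs' : (s : ℂ) ≠ 0 := by exact_mod_cast hs.ne'
  have ht' : (t : ℂ) ≠ 0 := by exact_mod_cast ht.ne'
  have hN : (0 : ℝ) < (2 * s * t : ℝ)⁻¹ := by
    have : (0 : ℝ) < s := by exact_mod_cast hs
    have : (0 : ℝ) < t := by exact_mod_cast ht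
    positivity
  have hinj : Function.Injective fun j : ℤ => c + 2 * s * t * j := by
    intro i j hij
    have : (2 * s * t) * i = (2 * s * t) * j := by simpa using hij
    exact mul_left_cancel₀ (by positivity) this
  have e1 : ∑' k : ℤ, (if k ≡ c [ZMOD 2 * s * t] then (1 : ℂ) else 0) * gterm s t τ k
      = ∑' j : ℤ, gterm s t τ (c + 2 * s * t * j) := by
    rw [← hinj.tsum_eq]
    · refine tsum_congr fun j => ?_
      rw [if_pos, one_mul]
      exact (Int.modEq_iff_dvd.mpr ⟨j, by ring⟩ : c ≡ _ [ZMOD _]).symm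
    · intro k hk
      by_cases h : k ≡ c [ZMOD 2 * s * t]
      · obtain ⟨j, hj⟩ := h.symm.dvd
        exact ⟨j, by simp only; linarith⟩
      · simp [h] at hk
  rw [e1]
  have hIτ : Complex.I / τ ≠ 0 := div_ne_zero Complex.I_ne_zero h0
  set a : ℂ := ((2 * s * t : ℝ)⁻¹ : ℝ) * (Complex.I / τ) with ha
  have ha0 : a ≠ 0 := mul_ne_zero (by exact_mod_cast hN.ne') hIτ
  have hre : 0 < a.re := by
    rw [ha, Complex.re_ofReal_mul]
    refine mul_pos hN ?_
    have : Complex.I / τ = -(Complex.I * (-1 / τ)) := by ring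
    rw [this, Complex.neg_re, Complex.I_mul_re, neg_neg]
    exact neg_inv_im τ hτ
  have key := Complex.tsum_exp_neg_quadratic hre (-Complex.I * c / (2 * s * t))
  have hcp : a ^ ((1 : ℂ) / 2) = (Real.sqrt (2 * s * t)⁻¹ : ℂ) * (Complex.I / τ) ^ ((1 : ℂ) / 2) :=
    cpow_half_scale _ hN _ hIτ
  have hcp0 : a ^ ((1 : ℂ) / 2) ≠ 0 := by
    rw [Complex.cpow_def_of_ne_zero ha0]; exact Complex.exp_ne_zero _
  have e2 : ∑' k : ℤ, Complex.exp (-(Real.pi * c * k / (s * t) : ℝ) * Complex.I)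
          * gterm s t (-1 / τ) k
      = ∑' n : ℤ, Complex.exp (-Real.pi * a * n ^ 2
          + 2 * Real.pi * (-Complex.I * c / (2 * s * t)) * n) := by
    refine tsum_congr fun k => ?_
    unfold gterm
    rw [← Complex.exp_add]
    congr 1
    rw [ha]
    push_cast
    field_simp
    ring
  have e3 : ∑' j : ℤ, gterm s t τ (c + 2 * s * t * j)
      = ∑' n : ℤ, Complex.exp (-Real.pi / a *
          (n + Complex.I * (-Complex.I * c / (2 * s * t))) ^ 2) := by
    refine tsum_congr fun k => ?_
    unfold gterm
    congr 1
    have h1 : Complex.I * (-Complex.I * c / (2 * s * t)) = c / (2 * s * t) := by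
      linear_combination (-(c : ℂ) / (2 * s * t)) * Complex.I_mul_I
    have h2 : -(Real.pi : ℂ) / a = Real.pi * (2 * s * t) * τ * Complex.I := by
      rw [div_eq_iff ha0, ha]
      push_cast
      field_simp
      linear_combination (-1) * Complex.I_sq
    rw [h1, h2]
    push_cast
    field_simp
    ring
  rw [e2, key, e3, mul_comm ((Complex.I / τ) ^ ((1 : ℂ) / 2)), ← hcp, ← mul_assoc,
    mul_one_div_cancel hcp0, one_mul]

lemma Phi_transform (s t n m : ℤ) (hs : 0 < s) (ht : 0 < t) (hst : IsCoprime s t)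
    (hn : 0 < n) (hns : n < s) (hm : 0 < m) (hmt : m < t) (τ : ℂ) (hτ : 0 < τ.im) :
    Phi s t n m τ = (Complex.I / τ) ^ ((1 : ℂ) / 2) *
      ∑' k : ℤ, ((2 * Real.sqrt (2 * s * t)⁻¹ * (Real.sin (Real.pi * n * k / s)
        * Real.sin (Real.pi * m * k / t)) : ℝ) : ℂ) * gterm s t (-1 / τ) k := by
  have hs' : (s : ℂ) ≠ 0 := by exact_mod_cast hs.ne'
  have ht' : (t : ℂ) ≠ 0 := by exact_mod_cast ht.ne'
  have hτ' := neg_inv_im τ hτ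
  have S1 : ∀ c : ℤ, Summable fun k : ℤ =>
      (if k ≡ c [ZMOD 2 * s * t] then (1 : ℂ) else 0) * gterm s t τ k := by
    intro c
    refine summable_gterm_mul s t hs ht τ hτ _ 1 ?_
    intro k; split_ifs <;> simp
  have S2 : ∀ c : ℤ, Summable fun k : ℤ =>
      Complex.exp (-(Real.pi * c * k / (s * t) : ℝ) * Complex.I) * gterm s t (-1 / τ) k := by
    intro c
    refine summable_gterm_mul s t hs ht _ hτ' _ 1 ?_
    intro k
    rw [← Complex.ofReal_neg, Complex.norm_exp_ofReal_mul_I]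
  have e0 : Phi s t n m τ = (1 / 2) * (
      ∑' k : ℤ, (if k ≡ n * t - m * s [ZMOD 2 * s * t] then (1 : ℂ) else 0) * gterm s t τ k
      + ∑' k : ℤ, (if k ≡ -(n * t - m * s) [ZMOD 2 * s * t] then (1 : ℂ) else 0) * gterm s t τ k
      - ∑' k : ℤ, (if k ≡ n * t + m * s [ZMOD 2 * s * t] then (1 : ℂ) else 0) * gterm s t τ k
      - ∑' k : ℤ, (if k ≡ -(n * t + m * s) [ZMOD 2 * s * t] then (1 : ℂ) else 0)
          * gterm s t τ k) := by
    rw [← (S1 _).tsum_add (S1 _), ← ((S1 _).add (S1 _)).tsum_sub (S1 _),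
      ← (((S1 _).add (S1 _)).sub (S1 _)).tsum_sub (S1 _)]
    unfold Phi
    congr 1
    refine tsum_congr fun k => ?_
    rw [chi_eq s t n m hs ht hst hn hns hm hmt k]
    push_cast
    unfold gterm
    ring
  rw [e0]
  simp only [tsum_class s t _ hs ht τ hτ]
  rw [← mul_add, ← mul_sub, ← mul_sub, ← (S2 _).tsum_add (S2 _),
      ← ((S2 _).add (S2 _)).tsum_sub (S2 _), ← (((S2 _).add (S2 _)).sub (S2 _)).tsum_sub (S2 _)]
  rw [← mul_assoc, mul_comm (1 / 2 : ℂ), mul_assoc, mul_assoc, mul_assoc]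
  congr 1
  rw [← tsum_mul_left, ← tsum_mul_left]
  refine tsum_congr fun k => ?_
  have hsr : (s : ℝ) ≠ 0 := by exact_mod_cast hs.ne'
  have htr : (t : ℝ) ≠ 0 := by exact_mod_cast ht.ne'
  have r1 : Real.pi * ((n * t - m * s : ℤ) : ℝ) * k / (s * t)
      = Real.pi * n * k / s - Real.pi * m * k / t := by push_cast; field_simp
  have r2 : Real.pi * ((-(n * t - m * s) : ℤ) : ℝ) * k / (s * t)
      = -(Real.pi * n * k / s - Real.pi * m * k / t) := by push_cast; field_simp
  have r3 : Real.pi * ((n * t + m * s : ℤ) : ℝ) * k / (s * t)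
      = Real.pi * n * k / s + Real.pi * m * k / t := by push_cast; field_simp
  have r4 : Real.pi * ((-(n * t + m * s) : ℤ) : ℝ) * k / (s * t)
      = -(Real.pi * n * k / s + Real.pi * m * k / t) := by push_cast; field_simp
  rw [r1, r2, r3, r4]
  generalize Real.pi * n * k / s = X
  generalize Real.pi * m * k / t = Y
  simp only [Complex.exp_mul_I, Complex.ofReal_neg, Complex.ofReal_mul, Complex.ofReal_add,
    Complex.ofReal_sub, Complex.cos_neg, Complex.sin_neg, Complex.cos_add, Complex.cos_sub,
    Complex.ofReal_sin, Complex.ofReal_ofNat, neg_neg]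
  ring

lemma neg_one_zpow_congr (u v w : ℤ) (h : u = v + 2 * w) : (-1 : ℝ) ^ u = (-1 : ℝ) ^ v := by
  rw [h, zpow_add₀ (by norm_num), (even_two_mul w).neg_one_zpow, mul_one]

lemma Scoef_chi (s t n m a b k : ℤ) (hs : 0 < s) (ht : 0 < t) (h : chi s t a b k ≠ 0) :
    Scoef s t n m a b * (1 / 2 * (chi s t a b k : ℝ)) =
      2 * Real.sqrt (2 * s * t)⁻¹ * (Real.sin (Real.pi * n * k / s)
        * Real.sin (Real.pi * m * k / t)) := by
  have hsr : (0 : ℝ) < s := by exact_mod_cast hs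
  have htr : (0 : ℝ) < t := by exact_mod_cast ht
  have hsq : Real.sqrt (8 / ((s : ℝ) * t)) = 4 * Real.sqrt (2 * s * t)⁻¹ := by
    have : (8 / ((s : ℝ) * t)) = 4 ^ 2 * (2 * s * t : ℝ)⁻¹ := by field_simp; norm_num
    rw [this, Real.sqrt_mul (by positivity), Real.sqrt_sq (by norm_num)]
  obtain ⟨e, d, j, he, hd, hk, hchi⟩ := chi_ne_zero _ _ _ _ _ h
  have hkr : (k : ℝ) = e * a * t + d * b * s + 2 * s * t * j := by exact_mod_cast hk
  have s1 : Real.sin (Real.pi * n * k / s)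
      = (-1) ^ (n * b) * (e * Real.sin (n * a * t * Real.pi / s)) := by
    have : Real.pi * n * k / s = e * (n * a * t * Real.pi / s)
        + ((d * b * n + 2 * t * j * n : ℤ) : ℝ) * Real.pi := by
      rw [hkr]; push_cast; field_simp; ring
    rw [this, Real.sin_add_int_mul_pi]
    rcases hd with rfl | rfl
    · rw [neg_one_zpow_congr _ (n * b) (t * j * n) (by ring)]
      rcases he with rfl | rfl <;> simp
    · rw [neg_one_zpow_congr _ (n * b) (t * j * n - n * b) (by ring)]
      rcases he with rfl | rfl <;> simp
  have s2 : Real.sin (Real.pi * m * k / t)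
      = (-1) ^ (a * m) * (d * Real.sin (m * b * s * Real.pi / t)) := by
    have : Real.pi * m * k / t = d * (m * b * s * Real.pi / t)
        + ((e * a * m + 2 * s * j * m : ℤ) : ℝ) * Real.pi := by
      rw [hkr]; push_cast; field_simp; ring
    rw [this, Real.sin_add_int_mul_pi]
    rcases he with rfl | rfl
    · rw [neg_one_zpow_congr _ (a * m) (s * j * m) (by ring)]
      rcases hd with rfl | rfl <;> simp
    · rw [neg_one_zpow_congr _ (a * m) (s * j * m - a * m) (by ring)]
      rcases hd with rfl | rfl <;> simp
  rw [s1, s2, hchi]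
  unfold Scoef
  rw [hsq, zpow_add₀ (by norm_num), zpow_add₀ (by norm_num)]
  push_cast
  rw [zpow_one]
  ring

lemma key_sum (s t n m k : ℤ) (hs : 0 < s) (ht : 0 < t) (hst : IsCoprime s t) :
    ∑ x ∈ (Finset.Icc (1 : ℤ) (s - 1) ×ˢ Finset.Icc (1 : ℤ) (t - 1)).filter
            (fun x => 0 < x.1 * t - x.2 * s),
          Scoef s t n m x.1 x.2 * (1 / 2 * (chi s t x.1 x.2 k : ℝ)) =
      2 * Real.sqrt (2 * s * t)⁻¹ * (Real.sin (Real.pi * n * k / s)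
        * Real.sin (Real.pi * m * k / t)) := by
  have hsr : (s : ℝ) ≠ 0 := by exact_mod_cast hs.ne'
  have htr : (t : ℝ) ≠ 0 := by exact_mod_cast ht.ne'
  by_cases hF : Real.sin (Real.pi * n * k / s) * Real.sin (Real.pi * m * k / t) = 0
  · rw [hF, mul_zero]
    refine Finset.sum_eq_zero fun x _ => ?_
    by_cases h : chi s t x.1 x.2 k = 0
    · simp [h]
    · rw [Scoef_chi s t n m _ _ k hs ht h, hF, mul_zero]
  have hks : ¬ s ∣ k := by
    rintro ⟨j, rfl⟩
    apply hF
    have : Real.pi * n * ((s * j : ℤ) : ℝ) / s = ((n * j : ℤ) : ℝ) * Real.pi := by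
      push_cast; field_simp
    rw [this, Real.sin_int_mul_pi, zero_mul]
  have hkt : ¬ t ∣ k := by
    rintro ⟨j, rfl⟩
    apply hF
    have : Real.pi * m * ((t * j : ℤ) : ℝ) / t = ((m * j : ℤ) : ℝ) * Real.pi := by
      push_cast; field_simp
    rw [this, Real.sin_int_mul_pi, mul_zero]
  obtain ⟨a, b, ha, has, hb, hbt, hp, hc⟩ := chi_exists s t k hs ht hst hks hkt
  rw [Finset.sum_eq_single (a, b)]
  · exact Scoef_chi s t n m a b k hs ht hc
  · rintro ⟨a', b'⟩ hx hne
    simp only [Finset.mem_filter, Finset.mem_product, Finset.mem_Icc] at hx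
    by_cases h : chi s t a' b' k = 0
    · simp [h]
    · exfalso
      obtain ⟨h1, h2⟩ := chi_unique s t a b a' b' k hs ht hst ha has hb hbt (by omega) (by omega)
        (by omega) (by omega) hp hx.2 hc h
      exact hne (by rw [h1, h2])
  · intro hx
    exfalso
    apply hx
    simp only [Finset.mem_filter, Finset.mem_product, Finset.mem_Icc]
    exact ⟨⟨⟨by omega, by omega⟩, ⟨by omega, by omega⟩⟩, hp⟩

lemma chi_bound (s t a b k : ℤ) : ‖(chi s t a b k : ℂ)‖ ≤ 1 := by
  by_cases h : chi s t a b k = 0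
  · simp [h]
  · obtain ⟨e, d, j, he, hd, -, hc⟩ := chi_ne_zero _ _ _ _ _ h
    rw [hc]
    rcases he with rfl | rfl <;> rcases hd with rfl | rfl <;> simp

lemma Phi_eq (s t a b : ℤ) (τ : ℂ) :
    Phi s t a b τ = 1 / 2 * ∑' k : ℤ, (chi s t a b k : ℂ) * gterm s t τ k := rfl

lemma sum_Phi (s t n m : ℤ) (hs : 0 < s) (ht : 0 < t) (τ : ℂ) (hτ : 0 < τ.im)
    (A : Finset (ℤ × ℤ)) :
    ∑ x ∈ A, (Scoef s t n m x.1 x.2 : ℂ) * Phi s t x.1 x.2 τ =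
      ∑' k : ℤ, ((∑ x ∈ A, Scoef s t n m x.1 x.2 * (1 / 2 * (chi s t x.1 x.2 k : ℝ)) : ℝ) : ℂ)
        * gterm s t τ k := by
  have S : ∀ a b : ℤ, Summable fun k : ℤ => (Scoef s t n m a b : ℂ) *
      (1 / 2 * ((chi s t a b k : ℂ) * gterm s t τ k)) := fun a b =>
    Summable.mul_left _ (Summable.mul_left _
      (summable_gterm_mul s t hs ht _ hτ _ 1 (chi_bound s t a b)))
  have e : ∀ a b : ℤ, (Scoef s t n m a b : ℂ) * Phi s t a b τ =
      ∑' k : ℤ, (Scoef s t n m a b : ℂ) *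
      (1 / 2 * ((chi s t a b k : ℂ) * gterm s t τ k)) := by
    intro a b
    rw [tsum_mul_left, tsum_mul_left, Phi_eq]
  have e2 := Summable.tsum_finsetSum (s := A) (fun x _ => S x.1 x.2)
  rw [Finset.sum_congr rfl (fun x _ => e x.1 x.2), ← e2]
  refine tsum_congr fun k => ?_
  rw [Complex.ofReal_sum, Finset.sum_mul]
  refine Finset.sum_congr rfl fun x _ => ?_
  simp only [Complex.ofReal_mul, Complex.ofReal_intCast, Complex.ofReal_div, Complex.ofReal_one,
    Complex.ofReal_ofNat]
  ring

theorem statement14 (s t n m : ℤ) (hs : 0 < s) (ht : 0 < t) (hst : IsCoprime s t)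
    (hn : 0 < n) (hns : n < s) (hm : 0 < m) (hmt : m < t) (τ : ℂ) (hτ : 0 < τ.im) :
    Phi s t n m τ =
      (Complex.I / τ) ^ ((1 : ℂ) / 2) *
        ∑ x ∈ (Finset.Icc (1 : ℤ) (s - 1) ×ˢ Finset.Icc (1 : ℤ) (t - 1)).filter
            (fun x => 0 < x.1 * t - x.2 * s),
          (Scoef s t n m x.1 x.2 : ℂ) * Phi s t x.1 x.2 (-1 / τ) := by
  rw [Phi_transform s t n m hs ht hst hn hns hm hmt τ hτ,
    sum_Phi s t n m hs ht _ (neg_inv_im τ hτ)]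
  refine congrArg _ (tsum_congr fun k => ?_)
  rw [key_sum s t n m k hs ht hst]
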